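/- For every integer n ≥ 1, the partition function satisfies p(n) ≥ exp(2√n)/14. -/

import Mathlib

/-- Values of the partition function below 100. -/
def ptab : List ℕ :=
  [1, 1, 2, 3, 5, 7, 11, 15, 22, 30, 42, 56, 77, 101, 135, 176, 231, 297, 385, 490, 627, 792,
   1002, 1255, 1575, 1958, 2436, 3010, 3718, 4565, 5604, 6842, 8349, 10143, 12310, 14883,
   17977, 21637, 26015, 31185, 37338, 44583, 53174, 63261, 75175, 89134, 105558, 124754,
   147273, 173525, 204226, 239943, 281589, 329931, 386155, 451276, 526823, 614154, 715220,
   831820, 966467, 1121505, 1300156, 1505499, 1741630, 2012558, 2323520, 2679689, 3087735,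
   3554345, 4087968, 4697205, 5392783, 6185689, 7089500, 8118264, 9289091, 10619863, 12132164,
   13848650, 15796476, 18004327, 20506255, 23338469, 26543660, 30167357, 34262962, 38887673,
   44108109, 49995925, 56634173, 64112359, 72533807, 82010177, 92669720, 104651419, 118114304,
   133230930, 150198136, 169229875]

/-- Upper bounds for 200 times the square root. -/
def atab : List ℕ :=
  [1, 201, 283, 347, 401, 448, 490, 530, 566, 601, 633, 664, 693, 722, 749, 775, 801, 825,
   849, 872, 895, 917, 939, 960, 980, 1001, 1020, 1040, 1059, 1078, 1096, 1114, 1132, 1149,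
   1167, 1184, 1201, 1217, 1233, 1249, 1265, 1281, 1297, 1312, 1327, 1342, 1357, 1372, 1386,
   1401, 1415, 1429, 1443, 1457, 1470, 1484, 1497, 1510, 1524, 1537, 1550, 1563, 1575, 1588,
   1601, 1613, 1625, 1638, 1650, 1662, 1674, 1686, 1698, 1709, 1721, 1733, 1744, 1755, 1767,
   1778, 1789, 1801, 1812, 1823, 1834, 1844, 1855, 1866, 1877, 1887, 1898, 1908, 1919, 1929,
   1940, 1950, 1960, 1970, 1980, 1990]

def qq (n : ℕ) : ℕ := ptab.getD n 0

def aa (n : ℕ) : ℕ := atab.getD n 0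

set_option maxRecDepth 100000 in
theorem tab_rec : ∀ n < 100, 1 ≤ n →
    n * qq n ≤ ∑ j ∈ Finset.Icc 1 n, ∑ m ∈ Finset.Icc 1 (n / j), m * qq (n - j * m) := by
  decide +kernel

set_option maxRecDepth 100000 in
theorem tab_num : ∀ n < 100, 1 ≤ n →
    40000 * n ≤ aa n ^ 2 ∧ 27183 ^ aa n ≤ (14 * qq n) ^ 100 * 10000 ^ aa n := by
  decide +kernel

theorem tab_exp (n : ℕ) (h : n < 100) (hn : 1 ≤ n) :
    Real.exp (2 * Real.sqrt n) ≤ 14 * (qq n : ℝ) := by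
  obtain ⟨h1, h2⟩ := tab_num n h hn
  have hs : 2 * Real.sqrt n ≤ (aa n : ℝ) / 100 := by
    have : Real.sqrt n ≤ (aa n : ℝ) / 200 := by
      rw [Real.sqrt_le_left (by positivity)]
      have : (40000 * n : ℝ) ≤ (aa n : ℝ) ^ 2 := by exact_mod_cast h1
      nlinarith
    linarith
  refine (Real.exp_le_exp.2 hs).trans ?_
  refine le_of_pow_le_pow_left₀ (n := 100) (by norm_num) (by positivity) ?_
  rw [← Real.exp_nat_mul]
  have e1 : ((100 : ℕ) : ℝ) * ((aa n : ℝ) / 100) = (aa n : ℝ) * 1 := by push_cast; ring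
  rw [e1, Real.exp_nat_mul]
  have e2 : Real.exp 1 ≤ 27183 / 10000 := by
    have := Real.exp_one_lt_d9
    norm_num at this ⊢
    linarith
  refine (pow_le_pow_left₀ (Real.exp_pos 1).le e2 _).trans ?_
  rw [div_pow, div_le_iff₀ (by positivity)]
  exact_mod_cast h2

/-- Number of partitions. -/
def pp (n : ℕ) : ℕ := Fintype.card (Nat.Partition n)

theorem pp_le_count (n m j : ℕ) (hm : 1 ≤ m) (h : j * m ≤ n) :
    pp (n - j * m) ≤ (Finset.univ.filter fun l : Nat.Partition n => j ≤ l.parts.count m).card := by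
  unfold pp
  rw [← Finset.card_univ]
  refine Finset.card_le_card_of_injOn
    (fun l => ⟨l.parts + Multiset.replicate j m, ?_, ?_⟩) ?_ ?_
  · intro i hi
    rcases Multiset.mem_add.1 hi with hi | hi
    · exact l.parts_pos hi
    · rw [Multiset.eq_of_mem_replicate hi]; omega
  · rw [Multiset.sum_add, l.parts_sum, Multiset.sum_replicate, smul_eq_mul]; omega
  · intro l _
    simp
  · intro a _ b _ hab
    simp only [Nat.Partition.mk.injEq] at hab
    exact Nat.Partition.ext (add_right_cancel hab)

theorem sum_count (n : ℕ) (l : Nat.Partition n) :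
    n = ∑ m ∈ Finset.Icc 1 n, l.parts.count m * m := by
  conv_lhs => rw [← l.parts_sum]
  rw [Finset.sum_multiset_count_of_subset l.parts (Finset.Icc 1 n)]
  · simp
  · intro i hi
    rw [Multiset.mem_toFinset] at hi
    have h1 := l.parts_pos hi
    have h2 : i ≤ l.parts.sum := Multiset.le_sum_of_mem hi
    rw [l.parts_sum] at h2
    simp; omega

theorem pp_rec (n J : ℕ) :
    ∑ j ∈ Finset.Icc 1 J, ∑ m ∈ Finset.Icc 1 (n / j), m * pp (n - j * m) ≤ n * pp n := by
  have e : n * pp n = ∑ l : Nat.Partition n, ∑ m ∈ Finset.Icc 1 n, l.parts.count m * m := by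
    rw [Finset.sum_congr rfl (fun l _ => (sum_count n l).symm)]
    simp [pp, mul_comm]
  have key : ∀ c m : ℕ, ∑ j ∈ Finset.Icc 1 J, (if j ≤ c then m else 0) ≤ c * m := by
    intro c m
    rw [← Finset.sum_filter, Finset.sum_const, smul_eq_mul]
    refine Nat.mul_le_mul_right _ ?_
    calc _ ≤ (Finset.Icc 1 c).card := Finset.card_le_card (by
          intro x; simp; omega)
      _ = c := by simp
  rw [e]
  calc _ ≤ ∑ j ∈ Finset.Icc 1 J, ∑ m ∈ Finset.Icc 1 n, ∑ l : Nat.Partition n,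
          (if j ≤ l.parts.count m then m else 0) := by
        refine Finset.sum_le_sum fun j hj => ?_
        rw [Finset.mem_Icc] at hj
        refine (Finset.sum_le_sum (g := fun m => ∑ l : Nat.Partition n,
          (if j ≤ l.parts.count m then m else 0)) fun m hm => ?_).trans
          (Finset.sum_le_sum_of_subset ?_)
        · rw [Finset.mem_Icc, Nat.le_div_iff_mul_le (by omega)] at hm
          rw [← Finset.sum_filter, Finset.sum_const, smul_eq_mul, mul_comm]
          exact Nat.mul_le_mul_right _ (pp_le_count n m j hm.1 (by linarith [hm.2, mul_comm m j]))
        · exact Finset.Icc_subset_Icc_right (Nat.div_le_self _ _)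
    _ = ∑ l : Nat.Partition n, ∑ m ∈ Finset.Icc 1 n, ∑ j ∈ Finset.Icc 1 J,
          (if j ≤ l.parts.count m then m else 0) := by
        rw [Finset.sum_comm]
        conv_rhs => rw [Finset.sum_comm]
        exact Finset.sum_congr rfl fun m _ => Finset.sum_comm
    _ ≤ _ := Finset.sum_le_sum fun l _ => Finset.sum_le_sum fun m _ => key _ _

theorem qq_le_pp (n : ℕ) (h : n < 100) : qq n ≤ pp n := by
  induction n using Nat.strong_induction_on with
  | _ n ih =>
    rcases Nat.eq_zero_or_pos n with rfl | hn
    · simp [pp, qq, ptab]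
    · have h1 := tab_rec n h hn
      have h2 := pp_rec n n
      refine Nat.le_of_mul_le_mul_left (h1.trans (le_trans ?_ h2)) hn
      refine Finset.sum_le_sum fun j hj => Finset.sum_le_sum fun m hm => ?_
      rw [Finset.mem_Icc] at hj hm
      have : 0 < j * m := Nat.mul_pos hj.1 hm.1
      exact Nat.mul_le_mul_left _ (ih _ (by omega) (by omega))

noncomputable def FF (y : ℝ) : ℝ := Real.exp (2 * √y)
noncomputable def GG (y : ℝ) : ℝ := (√y - 1 / 2) * Real.exp (2 * √y) + 1 / 2
noncomputable def HH (y : ℝ) : ℝ := (y - 3 / 2 * √y + 3 / 4) * Real.exp (2 * √y) + y / 2 - 3 / 4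

theorem FF_mono : Monotone FF := fun a b h => by
  unfold FF
  have := Real.sqrt_le_sqrt h
  gcongr

theorem GG_deriv (y : ℝ) (hy : 0 < y) : HasDerivAt GG (FF y) y := by
  have h1 := Real.hasDerivAt_sqrt hy.ne'
  have h2 := ((h1.sub_const (1 / 2)).mul (h1.const_mul 2).exp).add_const (1 / 2)
  refine h2.congr_deriv ?_
  have : √y ≠ 0 := (Real.sqrt_pos.2 hy).ne'
  unfold FF
  field_simp
  ring

theorem HH_deriv (y : ℝ) (hy : 0 < y) : HasDerivAt HH (GG y) y := by
  have h1 := Real.hasDerivAt_sqrt hy.ne'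
  have h2 := ((((hasDerivAt_id y).sub (h1.const_mul (3 / 2))).add_const (3 / 4)).mul
    (h1.const_mul 2).exp).add ((hasDerivAt_id y).div_const 2) |>.sub_const (3 / 4)
  refine h2.congr_deriv ?_
  have : √y ≠ 0 := (Real.sqrt_pos.2 hy).ne'
  have h3 : y = √y ^ 2 := (Real.sq_sqrt hy.le).symm
  unfold GG
  simp only [Pi.sub_apply, id]
  generalize √y = s at *
  subst h3
  field_simp
  ring

theorem GG_cont : Continuous GG := by unfold GG; fun_prop
theorem HH_cont : Continuous HH := by unfold HH; fun_prop

theorem mvt (f g : ℝ → ℝ) (hf : Continuous f) (hd : ∀ y, 0 < y → HasDerivAt f (g y) y)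
    (hg : ∀ a b, 0 ≤ a → a ≤ b → g a ≤ g b) (a b : ℝ) (ha : 0 ≤ a) (hab : a ≤ b) :
    f b - f a ≤ (b - a) * g b := by
  rcases hab.eq_or_lt with rfl | hlt
  · simp
  · obtain ⟨c, hc, h⟩ := exists_hasDerivAt_eq_slope f g hlt hf.continuousOn
      (fun x hx => hd x (ha.trans_lt hx.1))
    have := hg c b (ha.trans hc.1.le) hc.2.le
    rw [h, div_le_iff₀ (by linarith)] at this
    linarith

theorem GG_step (a b : ℝ) (ha : 0 ≤ a) (hab : a ≤ b) : GG b - GG a ≤ (b - a) * FF b :=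
  mvt GG FF GG_cont GG_deriv (fun _ _ _ h => FF_mono h) a b ha hab

theorem GG_mono (a b : ℝ) (ha : 0 ≤ a) (hab : a ≤ b) : GG a ≤ GG b := by
  rcases hab.eq_or_lt with rfl | hlt
  · simp
  · obtain ⟨c, hc, h⟩ := exists_hasDerivAt_eq_slope GG FF hlt GG_cont.continuousOn
      (fun x hx => GG_deriv x (ha.trans_lt hx.1))
    have : 0 < FF c := Real.exp_pos _
    rw [h] at this
    have := (div_pos_iff_of_pos_right (by linarith)).1 this
    linarith

theorem HH_step (a b : ℝ) (ha : 0 ≤ a) (hab : a ≤ b) : HH b - HH a ≤ (b - a) * GG b :=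
  mvt HH GG HH_cont HH_deriv GG_mono a b ha hab

theorem GG_zero : GG 0 = 0 := by simp [GG]
theorem HH_zero : HH 0 = 0 := by simp [HH]

theorem U_bound (j : ℕ) (hj : 1 ≤ j) (y : ℕ) :
    GG y ≤ j * ∑ m ∈ Finset.range (y / j + 1), FF ((y - j * m : ℕ) : ℝ) := by
  induction y using Nat.strong_induction_on with
  | _ y ih =>
    have hF : ∀ x, 0 ≤ FF x := fun x => (Real.exp_pos _).le
    rw [Finset.sum_range_succ']
    rcases lt_or_ge y j with h | h
    · have := GG_step 0 y le_rfl (by positivity)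
      rw [GG_zero] at this
      have h' : (y : ℝ) ≤ j := by exact_mod_cast h.le
      rw [Nat.div_eq_of_lt h]
      simp
      nlinarith [hF y]
    · have h1 := ih (y - j) (by omega)
      have h2 := GG_step (y - j : ℕ) y (by positivity) (by exact_mod_cast Nat.sub_le _ _)
      rw [Nat.cast_sub h] at h2 h1
      have e : y / j = (y - j) / j + 1 := Nat.div_eq_sub_div (by omega) h
      have e2 : ∀ m, y - j * (m + 1) = y - j - j * m := fun m => by
        rw [mul_add, mul_one, Nat.sub_sub, add_comm]
      simp only [e2]
      rw [e, mul_add]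
      simp only [mul_zero, Nat.sub_zero]
      linarith

theorem V_bound (j : ℕ) (hj : 1 ≤ j) (y : ℕ) :
    HH y ≤ j ^ 2 * ∑ m ∈ Finset.range (y / j + 1), (m + 1 : ℝ) * FF ((y - j * m : ℕ) : ℝ) := by
  induction y using Nat.strong_induction_on with
  | _ y ih =>
    have hU := U_bound j hj y
    have hj0 : (1 : ℝ) ≤ j := by exact_mod_cast hj
    rcases lt_or_ge y j with h | h
    · have := HH_step 0 y le_rfl (by positivity)
      rw [HH_zero] at this
      have h0 := GG_mono 0 y le_rfl (by positivity)
      rw [GG_zero] at h0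
      have h' : (y : ℝ) ≤ j := by exact_mod_cast h.le
      rw [Nat.div_eq_of_lt h] at hU ⊢
      simp at hU ⊢
      nlinarith
    · have h1 := ih (y - j) (by omega)
      have h2 := HH_step (y - j : ℕ) y (by positivity) (by exact_mod_cast Nat.sub_le _ _)
      rw [Nat.cast_sub h] at h2 h1
      have e : y / j = (y - j) / j + 1 := Nat.div_eq_sub_div (by omega) h
      have e2 : ∀ m, y - j * (m + 1) = y - j - j * m := fun m => by
        rw [mul_add, mul_one, Nat.sub_sub, add_comm]
      have e3 : ∑ m ∈ Finset.range (y / j + 1), (m + 1 : ℝ) * FF ((y - j * m : ℕ) : ℝ)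
          = ∑ m ∈ Finset.range (y / j + 1), FF ((y - j * m : ℕ) : ℝ)
          + ∑ m ∈ Finset.range ((y - j) / j + 1), (m + 1 : ℝ) * FF ((y - j - j * m : ℕ) : ℝ) := by
        simp only [add_mul, one_mul, Finset.sum_add_distrib]
        rw [Finset.sum_range_succ' (fun m : ℕ => (m : ℝ) * FF ((y - j * m : ℕ) : ℝ)), e]
        simp only [e2, Nat.cast_zero, zero_mul, add_zero]
        push_cast
        simp only [add_mul, one_mul, Finset.sum_add_distrib]
        ring
      rw [e3, mul_add]
      nlinarith

theorem S_bound (j : ℕ) (hj : 1 ≤ j) (n : ℕ) (hn : j ≤ n) :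
    HH n - j * GG n ≤
      j ^ 2 * ∑ m ∈ Finset.Icc 1 (n / j), (m : ℝ) * FF ((n - j * m : ℕ) : ℝ) := by
  have h1 := V_bound j hj (n - j)
  have h2 := HH_step (n - j : ℕ) n (by positivity) (by exact_mod_cast Nat.sub_le _ _)
  have e : n / j = (n - j) / j + 1 := Nat.div_eq_sub_div (by omega) hn
  have e2 : ∀ m, n - j * (1 + m) = n - j - j * m := fun m => by
    rw [mul_add, mul_one, Nat.sub_sub]
  have e3 : ∑ m ∈ Finset.Icc 1 (n / j), (m : ℝ) * FF ((n - j * m : ℕ) : ℝ)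
      = ∑ m ∈ Finset.range ((n - j) / j + 1), (m + 1 : ℝ) * FF ((n - j - j * m : ℕ) : ℝ) := by
    rw [← Finset.Ico_add_one_right_eq_Icc, Finset.sum_Ico_eq_sum_range, e]
    simp only [e2]
    refine Finset.sum_congr (by simp) fun m _ => ?_
    push_cast; ring
  rw [e3]
  rw [Nat.cast_sub hn] at h2 h1
  linarith

theorem final_ineq (n : ℕ) (hn : 100 ≤ n) :
    n * FF n ≤ ∑ j ∈ Finset.Icc 1 4, ∑ m ∈ Finset.Icc 1 (n / j),
      (m : ℝ) * FF ((n - j * m : ℕ) : ℝ) := by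
  have h1 := S_bound 1 (by norm_num) n (by omega)
  have h2 := S_bound 2 (by norm_num) n (by omega)
  have h3 := S_bound 3 (by norm_num) n (by omega)
  have h4 := S_bound 4 (by norm_num) n (by omega)
  have e : Finset.Icc 1 4 = ({1, 2, 3, 4} : Finset ℕ) := by decide
  rw [e, Finset.sum_insert (by simp), Finset.sum_insert (by simp), Finset.sum_insert (by simp),
    Finset.sum_singleton]
  push_cast at h1 h2 h3 h4
  have hn' : (100 : ℝ) ≤ n := by exact_mod_cast hn
  have hs : 10 ≤ √(n : ℝ) := Real.le_sqrt_of_sq_le (by linarith)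
  have hsq : (n : ℝ) = √(n : ℝ) ^ 2 := (Real.sq_sqrt (by positivity)).symm
  have hE : 1 ≤ Real.exp (2 * √(n : ℝ)) := Real.one_le_exp (by positivity)
  have hG : GG n ≤ √(n : ℝ) * Real.exp (2 * √(n : ℝ)) := by unfold GG; linarith
  have hH : (n - 3 / 2 * √(n : ℝ)) * Real.exp (2 * √(n : ℝ)) ≤ HH n := by unfold HH; linarith
  have hF : FF n = Real.exp (2 * √(n : ℝ)) := rfl
  have hmain : n * FF n ≤ 205 / 144 * HH n - 25 / 12 * GG n := by
    rw [hF]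
    have : 0 ≤ (205 / 144 * (n - 3 / 2 * √(n : ℝ)) - 25 / 12 * √(n : ℝ) - n)
        * Real.exp (2 * √(n : ℝ)) := by
      refine mul_nonneg ?_ (by positivity)
      nlinarith
    linarith
  linarith

theorem main_bound (n : ℕ) : FF n ≤ 14 * (pp n : ℝ) := by
  induction n using Nat.strong_induction_on with
  | _ n ih =>
    rcases lt_or_ge n 100 with h | h
    · rcases Nat.eq_zero_or_pos n with rfl | hn
      · simp [pp, FF]
      · have h1 := tab_exp n h hn
        have h2 : (qq n : ℝ) ≤ pp n := by exact_mod_cast qq_le_pp n h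
        unfold FF
        linarith
    · have h1 := final_ineq n h
      have h2 : ((∑ j ∈ Finset.Icc 1 4, ∑ m ∈ Finset.Icc 1 (n / j), m * pp (n - j * m) : ℕ) : ℝ)
          ≤ ((n * pp n : ℕ) : ℝ) := by exact_mod_cast pp_rec n 4
      push_cast at h2
      have h3 : ∑ j ∈ Finset.Icc 1 4, ∑ m ∈ Finset.Icc 1 (n / j),
            (m : ℝ) * FF ((n - j * m : ℕ) : ℝ)
          ≤ 14 * ∑ j ∈ Finset.Icc 1 4, ∑ m ∈ Finset.Icc 1 (n / j),
            (m : ℝ) * (pp (n - j * m) : ℝ) := by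
        simp only [Finset.mul_sum]
        refine Finset.sum_le_sum fun j hj => Finset.sum_le_sum fun m hm => ?_
        rw [Finset.mem_Icc] at hj hm
        have : 0 < j * m := Nat.mul_pos hj.1 hm.1
        have := mul_le_mul_of_nonneg_left (ih (n - j * m) (by omega)) (Nat.cast_nonneg (α := ℝ) m)
        linarith
      have hn : (0 : ℝ) < n := by exact_mod_cast (by omega : 0 < n)
      refine le_of_mul_le_mul_left ?_ hn
      linarith

theorem partition_lower_bound (n : ℕ) (hn : 1 ≤ n) :
    Real.exp (2 * Real.sqrt n) / 14 ≤ (Nat.card (Nat.Partition n) : ℝ) := by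
  have h := main_bound n
  rw [Nat.card_eq_fintype_card]
  unfold FF pp at h
  linarith
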